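/- arXiv:1209.2038 — 3 statements merged into one kernel-verified Lean document; each statement's English description precedes it below -/
import Mathlib

section
/- The map f sends stochastically recurrent configurations to stochastically recurrent configurations: if η ∈ Sto_A(G) then f(η) = η − 1_a belongs to Sto(G∖e), and if η ∈ Sto_B(G) then f(η) belongs to Sto(G.e). -/
open Finset Polynomial

open scoped Classical

namespace SSM

variable {V : Type*} [Fintype V] [DecidableEq V]

/-- The degree of a vertex: sum of edge multiplicities to all other vertices.
    Vertices are `Option V`, with `none` playing the role of the sink `s`. -/
def deg (m : Option V → Option V → ℕ) (u : Option V) : ℕ := ∑ w : Option V, m u w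

/-- `m` is a symmetric, loop-free edge-multiplicity function whose underlying
    graph is connected. -/
def IsGraph (m : Option V → Option V → ℕ) : Prop :=
  (∀ u w, m u w = m w u) ∧ (∀ u, m u u = 0) ∧
    (SimpleGraph.fromRel fun u w : Option V => m u w ≠ 0).Connected

/-- An orientation of the multigraph: `o u w` copies of the edge `{u,w}` are
    oriented from `u` to `w`, and `o u w + o w u = m u w`. -/
def IsOrientation (m o : Option V → Option V → ℕ) : Prop :=
  ∀ u w, o u w + o w u = m u w

/-- In-degree of a vertex in an orientation. -/
def inDeg (o : Option V → Option V → ℕ) (w : Option V) : ℕ := ∑ u : Option V, o u w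

/-- A configuration is stable if every non-sink vertex carries at most its degree. -/
def Stable (m : Option V → Option V → ℕ) (η : V → ℕ) : Prop :=
  ∀ v : V, η v ≤ deg m (some v)

/-- `η` is compatible with the orientation `o`: for each non-sink vertex `v`,
    `in_O(v) ≥ 1 + l_η(v)`, stated additively as `deg v + 1 ≤ in_O(v) + η v`. -/
def Compatible (m o : Option V → Option V → ℕ) (η : V → ℕ) : Prop :=
  ∀ v : V, deg m (some v) + 1 ≤ inDeg o (some v) + η v

/-- The set `Sto(G)`: stable configurations compatible with at least one orientation. -/
def Sto (m : Option V → Option V → ℕ) (η : V → ℕ) : Prop :=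
  Stable m η ∧ ∃ o, IsOrientation m o ∧ Compatible m o η

/-- Total lacking number `ℓ(η) = ∑_v (deg v − η v)`. -/
def totalLacking (m : Option V → Option V → ℕ) (η : V → ℕ) : ℕ :=
  ∑ v : V, (deg m (some v) - η v)

/-- The lacking polynomial `L_G(x) = ∑_{η ∈ Sto(G)} x^{ℓ(η)}`. -/
noncomputable def lackingPoly (m : Option V → Option V → ℕ) : Polynomial ℤ :=
  ∑ η ∈ (Fintype.piFinset fun v : V => Finset.range (deg m (some v) + 1)).filter
      (fun η => Sto m η),
    (X : Polynomial ℤ) ^ totalLacking m η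

/-- The maximal stable configuration `η^max`. -/
def etaMax (m : Option V → Option V → ℕ) : V → ℕ := fun v => deg m (some v)

/-- A grain addition at some non-sink vertex. -/
def AddGrain (η η' : V → ℕ) : Prop := ∃ v : V, η' = Function.update η v (η v + 1)

/-- A legal partial toppling: some vertex `x` with `η x > deg x` sends `α u ≤ m x u`
    grains to each vertex `u` (grains sent to the sink are lost). -/
def PartialTopple (m : Option V → Option V → ℕ) (η η' : V → ℕ) : Prop :=
  ∃ x : V, deg m (some x) < η x ∧ ∃ α : Option V → ℕ, (∀ u, α u ≤ m (some x) u) ∧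
    ∀ v : V, η' v = if v = x then η x - ∑ u : Option V, α u else η v + α (some v)

/-- Reachability by a finite sequence of grain additions and legal partial topplings. -/
def Reaches (m : Option V → Option V → ℕ) : (V → ℕ) → (V → ℕ) → Prop :=
  Relation.ReflTransGen fun η η' => AddGrain η η' ∨ PartialTopple m η η'

/-- A legal full toppling (Abelian sandpile model): an unstable vertex `x` sends
    `m x u` grains to each vertex `u`. -/
def FullTopple (m : Option V → Option V → ℕ) (η η' : V → ℕ) : Prop :=
  ∃ x : V, deg m (some x) < η x ∧
    ∀ v : V, η' v = if v = x then η x - deg m (some x) else η v + m (some x) (some v)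

/-- `η` passes the burning algorithm: the non-sink vertices can be enumerated
    `v_1, …, v_n` with `η(v_i) > ∑_{j > i} m(v_i, v_j)`. -/
def Burns (m : Option V → Option V → ℕ) (η : V → ℕ) : Prop :=
  ∃ e : Fin (Fintype.card V) ≃ V, ∀ i : Fin (Fintype.card V),
    ∑ j ∈ Finset.univ.filter (fun j : Fin (Fintype.card V) => i < j),
      m (some (e i)) (some (e j)) < η (e i)

/-- An orientation is acyclic if the digraph with an arc `u → w` whenever
    `o u w ≥ 1` has no directed cycle. -/
def IsAcyclic (o : Option V → Option V → ℕ) : Prop :=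
  ∀ u : Option V, ¬ Relation.TransGen (fun x y : Option V => 1 ≤ o x y) u u

/-- Deletion of one copy of the edge `{a,b}`. -/
def deleteM (m : Option V → Option V → ℕ) (a b : V) (u w : Option V) : ℕ :=
  if (u = some a ∧ w = some b) ∨ (u = some b ∧ w = some a) then m u w - 1 else m u w

/-- Contraction of the edge `{a,b}`: merge `b` into `a` (the merged vertex `a.b` is
    represented by `a` in the subtype `{v // v ≠ b}`), delete all `k = m a b` edges
    between `a` and `b`, and add `k − 1` new edges between `a.b` and the sink. -/
def contractM (m : Option V → Option V → ℕ) (a b : V) :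
    Option {v : V // v ≠ b} → Option {v : V // v ≠ b} → ℕ
  | none, none => 0
  | none, some w =>
      if w.1 = a then m none (some a) + m none (some b) + (m (some a) (some b) - 1)
      else m none (some w.1)
  | some u, none =>
      if u.1 = a then m none (some a) + m none (some b) + (m (some a) (some b) - 1)
      else m (some u.1) none
  | some u, some w =>
      if u.1 = a then
        (if w.1 = a then 0 else m (some a) (some w.1) + m (some b) (some w.1))
      else if w.1 = a then m (some u.1) (some a) + m (some u.1) (some b)
      else m (some u.1) (some w.1)

/-- `Sto_A(G)`: configurations in `Sto(G)` having a compatible orientation with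
    `o(a,b) ≥ 1` and `l_η(b) > 0`. -/
def StoA (m : Option V → Option V → ℕ) (a b : V) (η : V → ℕ) : Prop :=
  Stable m η ∧ ∃ o, IsOrientation m o ∧ Compatible m o η ∧
    1 ≤ o (some a) (some b) ∧ η b < deg m (some b)

/-- `Sto_B(G) = Sto(G) ∖ Sto_A(G)`. -/
def StoB (m : Option V → Option V → ℕ) (a b : V) (η : V → ℕ) : Prop :=
  Sto m η ∧ ¬ StoA m a b η

/-- On `Sto_A(G)`, `f(η) = η − 1_a`, a configuration on `G∖e`. -/
def fA (a : V) (η : V → ℕ) : V → ℕ := Function.update η a (η a - 1)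

/-- On `Sto_B(G)`, `f(η)` is the configuration on `G.e` agreeing with `η` away from
    `a, b` and with `f(η)(a.b) = deg_{G.e}(a.b) − l_η(a) − l_η(b)`. -/
def fB (m : Option V → Option V → ℕ) (a b : V) (hab : a ≠ b) (η : V → ℕ)
    (v : {v : V // v ≠ b}) : ℕ :=
  if v.1 = a then
    deg (contractM m a b) (some ⟨a, hab⟩) -
      ((deg m (some a) - η a) + (deg m (some b) - η b))
  else η v.1

/-- `T = (V' ∪ {r}, E')` is a tree branch of `G`: a sub-multigraph (with edge
    multiplicities `mT` on non-sink vertices) which is a tree on `V' ∪ {r}`,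
    such that every `v ∈ V'` has all of its `G`-edges inside `T`, and which is
    attached to the rest of `G` only at `r ∈ V ∖ V'`. -/
structure IsTreeBranch (m : Option V → Option V → ℕ) (V' : Finset V) (r : V)
    (mT : V → V → ℕ) : Prop where
  not_mem : r ∉ V'
  symm : ∀ u v, mT u v = mT v u
  loopless : ∀ v, mT v v = 0
  le : ∀ u v, mT u v ≤ m (some u) (some v)
  support : ∀ u v, mT u v ≠ 0 → (u ∈ V' ∨ u = r) ∧ (v ∈ V' ∨ v = r)
  deg_eq : ∀ v ∈ V', ∑ u : V, mT v u = deg m (some v)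
  conn : ∀ v ∈ V', (SimpleGraph.fromRel fun x y : V => mT x y ≠ 0).Reachable r v
  card_edges : ∑ u : V, ∑ v : V, mT u v = 2 * V'.card

theorem sum_sub_ne (b : V) (F : V → ℕ) :
    (∑ v : {v : V // v ≠ b}, F v.1) + F b = ∑ v, F v := by
  rw [Fintype.sum_eq_add_sum_subtype_ne F b, add_comm]

theorem sum_sub_ite (a b : V) (hab : a ≠ b) (F : V → ℕ) (c : ℕ) :
    (∑ v : {v : V // v ≠ b}, if v.1 = a then c else F v.1) + F a + F b = (∑ v, F v) + c := by
  have h1 := sum_sub_ne b (fun v => if v = a then c else F v)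
  have h2 : (∑ v, if v = a then c else F v) + F a = (∑ v, F v) + c := by
    rw [← Finset.add_sum_erase univ _ (mem_univ a), ← Finset.add_sum_erase univ F (mem_univ a)]
    have : ∑ x ∈ univ.erase a, (if x = a then c else F x) = ∑ x ∈ univ.erase a, F x := by
      apply Finset.sum_congr rfl
      intro x hx
      rw [if_neg (Finset.ne_of_mem_erase hx)]
    rw [this]
    simp only [if_true]
    omega
  simp only [if_neg hab.symm] at h1
  omega

/-- induced orientation of the contraction -/
def contractO (o : Option V → Option V → ℕ) (k : ℕ) (a b : V) :
    Option {v : V // v ≠ b} → Option {v : V // v ≠ b} → ℕ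
  | none, none => 0
  | none, some w =>
      if w.1 = a then o none (some a) + o none (some b) + (k - 1)
      else o none (some w.1)
  | some u, none =>
      if u.1 = a then o (some a) none + o (some b) none
      else o (some u.1) none
  | some u, some w =>
      if u.1 = a then
        (if w.1 = a then 0 else o (some a) (some w.1) + o (some b) (some w.1))
      else if w.1 = a then o (some u.1) (some a) + o (some u.1) (some b)
      else o (some u.1) (some w.1)

theorem partA (m : Option V → Option V → ℕ)
    (a b : V) (hab : a ≠ b) (hk : 1 ≤ m (some a) (some b)) (hs : ∀ u w, m u w = m w u)
    (η : V → ℕ) (h : StoA m a b η) : Sto (deleteM m a b) (fA a η) := by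
  obtain ⟨hst, o, ho, hc, h1, h2⟩ := h
  have hda : deg (deleteM m a b) (some a) + 1 = deg m (some a) := by
    unfold deg
    rw [← Finset.add_sum_erase univ _ (mem_univ (some b)),
      ← Finset.add_sum_erase univ (m (some a)) (mem_univ (some b))]
    have : ∑ x ∈ univ.erase (some b), deleteM m a b (some a) x
        = ∑ x ∈ univ.erase (some b), m (some a) x := by
      apply Finset.sum_congr rfl
      intro x hx
      have := Finset.ne_of_mem_erase hx
      simp [deleteM, this, hab]
    rw [this]
    simp [deleteM]
    omega
  have hdb : deg (deleteM m a b) (some b) + 1 = deg m (some b) := by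
    unfold deg
    rw [← Finset.add_sum_erase univ _ (mem_univ (some a)),
      ← Finset.add_sum_erase univ (m (some b)) (mem_univ (some a))]
    have : ∑ x ∈ univ.erase (some a), deleteM m a b (some b) x
        = ∑ x ∈ univ.erase (some a), m (some b) x := by
      apply Finset.sum_congr rfl
      intro x hx
      have := Finset.ne_of_mem_erase hx
      simp [deleteM, this, hab.symm]
    rw [this]
    have := hs (some b) (some a)
    simp [deleteM]
    omega
  have hdv : ∀ v, v ≠ a → v ≠ b → deg (deleteM m a b) (some v) = deg m (some v) := by
    intro v hva hvb
    simp [deg, deleteM, hva, hvb]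
  have hina : inDeg o (some a) ≤ deg m (some a) := by
    unfold inDeg deg
    apply Finset.sum_le_sum
    intro i _
    have := ho (some a) i
    omega
  refine ⟨?_, fun u w => if u = some a ∧ w = some b then o u w - 1 else o u w, ?_, ?_⟩
  · intro v
    have := hst v
    by_cases hva : v = a
    · subst hva; simp [fA]; omega
    · by_cases hvb : v = b
      · subst hvb; simp [fA, hva]; omega
      · simp [fA, hva, hdv v hva hvb]; omega
  · intro u w
    have h0 := ho u w
    have hab' : (some a) ≠ some b := by simpa using hab
    by_cases c1 : u = some a ∧ w = some b
    · obtain ⟨rfl, rfl⟩ := c1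
      simp [deleteM, hab, hab.symm]; omega
    · by_cases c2 : u = some b ∧ w = some a
      · obtain ⟨rfl, rfl⟩ := c2
        simp [deleteM, hab, hab.symm]; omega
      · have c3 : ¬ (w = some a ∧ u = some b) := fun h => c2 ⟨h.2, h.1⟩
        simp only [deleteM, if_neg c1, if_neg c3, c1, c2, or_self, if_false]
        exact h0
  · intro v
    have h0 := hc v
    by_cases hvb : v = b
    · subst hvb
      have : inDeg (fun u w => if u = some a ∧ w = some v then o u w - 1 else o u w) (some v) + 1
          = inDeg o (some v) := by
        unfold inDeg
        rw [← Finset.add_sum_erase univ _ (mem_univ (some a)),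
          ← Finset.add_sum_erase univ (fun u => o u (some v)) (mem_univ (some a))]
        have : ∑ x ∈ univ.erase (some a),
            (if x = some a ∧ some v = some v then o x (some v) - 1 else o x (some v))
            = ∑ x ∈ univ.erase (some a), o x (some v) := by
          apply Finset.sum_congr rfl
          intro x hx
          have := Finset.ne_of_mem_erase hx
          simp [this]
        rw [this]
        simp
        omega
      simp only [fA, Function.update_of_ne hab.symm]
      omega
    · have : inDeg (fun u w => if u = some a ∧ w = some b then o u w - 1 else o u w) (some v)
          = inDeg o (some v) := by
        simp [inDeg, hvb]
      rw [this]
      by_cases hva : v = a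
      · subst hva
        simp only [fA, Function.update_self]
        omega
      · simp only [fA, Function.update_of_ne hva, hdv v hva hvb]
        omega

theorem partB (m : Option V → Option V → ℕ)
    (a b : V) (hab : a ≠ b) (hk : 1 ≤ m (some a) (some b)) (hs : ∀ u w, m u w = m w u)
    (hl : ∀ u, m u u = 0)
    (η : V → ℕ) (h : Sto m η) : Sto (contractM m a b) (fB m a b hab η) := by
  obtain ⟨hst, o, ho, hc⟩ := h
  have hdv : ∀ v : {v : V // v ≠ b}, v.1 ≠ a →
      deg (contractM m a b) (some v) = deg m (some v.1) := by
    intro v hva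
    have := sum_sub_ite a b hab (fun w => m (some v.1) (some w))
      (m (some v.1) (some a) + m (some v.1) (some b))
    unfold deg
    rw [Fintype.sum_option, Fintype.sum_option]
    simp only [contractM, if_neg hva]
    omega
  have hiv : ∀ v : {v : V // v ≠ b}, v.1 ≠ a →
      inDeg (contractO o (m (some a) (some b)) a b) (some v) = inDeg o (some v.1) := by
    intro v hva
    have := sum_sub_ite a b hab (fun w => o (some w) (some v.1))
      (o (some a) (some v.1) + o (some b) (some v.1))
    unfold inDeg
    rw [Fintype.sum_option, Fintype.sum_option]
    simp only [contractO, if_neg hva]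
    omega
  have hia : inDeg (contractO o (m (some a) (some b)) a b) (some ⟨a, hab⟩) + 1
      = inDeg o (some a) + inDeg o (some b) := by
    have := sum_sub_ite a b hab (fun w => o (some w) (some a) + o (some w) (some b)) 0
    unfold inDeg
    rw [Fintype.sum_option, Fintype.sum_option, Fintype.sum_option]
    simp only [contractO, if_true]
    rw [Finset.sum_add_distrib] at this
    have h1 := ho (some a) (some b)
    have h2 := ho (some a) (some a)
    have h3 := ho (some b) (some b)
    rw [hl] at h2 h3
    omega
  refine ⟨?_, contractO o (m (some a) (some b)) a b, ?_, ?_⟩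
  · intro v
    by_cases hva : v.1 = a
    · obtain ⟨v, hv⟩ := v
      simp only at hva
      subst hva
      simp [fB]
    · rw [hdv v hva]
      simp only [fB, if_neg hva]
      exact hst _
  · rintro (_ | u) (_ | w)
    · rfl
    · have h1 := ho none (some a)
      have h2 := ho none (some b)
      have h3 := ho none (some w.1)
      simp only [contractO, contractM]
      split_ifs <;> omega
    · have h1 := ho none (some a)
      have h2 := ho none (some b)
      have h3 := ho (some u.1) none
      simp only [contractO, contractM]
      split_ifs <;> omega
    · have h1 := ho (some u.1) (some w.1)
      have h2 := ho (some a) (some w.1)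
      have h3 := ho (some b) (some w.1)
      have h4 := ho (some u.1) (some a)
      have h5 := ho (some u.1) (some b)
      simp only [contractO, contractM]
      split_ifs <;> omega
  · intro v
    by_cases hva : v.1 = a
    · obtain ⟨v, hv⟩ := v
      simp only at hva
      subst hva
      have h1 := hc v
      have h2 := hc b
      have h3 := hst v
      have h4 := hst b
      simp only [fB, if_true]
      omega
    · rw [hdv v hva, hiv v hva]
      simp only [fB, if_neg hva]
      exact hc _

/-- `f` sends stochastically recurrent configurations to
stochastically recurrent configurations: on `Sto_A(G)`, `f(η) = η − 1_a ∈ Sto(G∖e)`;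
on `Sto_B(G)`, `f(η) ∈ Sto(G.e)`. -/
theorem fMap_wellDefined (m : Option V → Option V → ℕ) (hG : IsGraph m)
    (a b : V) (hab : a ≠ b) (hk : 1 ≤ m (some a) (some b))
    (hnotbridge : (SimpleGraph.fromRel fun u w : Option V =>
      deleteM m a b u w ≠ 0).Connected) :
    (∀ η : V → ℕ, StoA m a b η → Sto (deleteM m a b) (fA a η)) ∧
    (∀ η : V → ℕ, StoB m a b η → Sto (contractM m a b) (fB m a b hab η)) := by
  exact ⟨fun η h => partA m a b hab hk hG.1 η h,
    fun η h => partB m a b hab hk hG.1 hG.2.1 η h.1⟩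

end SSM
end

section
/- The restriction of f to Sto_B(G) is surjective onto Sto(G.e): for every η ∈ Sto(G.e) there exists η' ∈ Sto_B(G) with f(η') = η. -/
open Finset Polynomial

open scoped Classical

namespace SSM

variable {V : Type*} [Fintype V] [DecidableEq V]

def iota (a b : V) (hab : a ≠ b) : Option V → Option {v : V // v ≠ b}
  | none => none
  | some v => if h : v ≠ b then some ⟨v, h⟩ else some ⟨a, hab⟩

lemma sum_split (a b : V) (hab : a ≠ b) (f : Option V → ℕ) :
    ∑ u : Option V, f u =
      f (some a) + f (some b) + ∑ u ∈ (univ.erase (some a)).erase (some b), f u := by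
  rw [← Finset.add_sum_erase univ f (mem_univ (some a)),
    ← Finset.add_sum_erase (univ.erase (some a)) f
      (a := some b) (by simp [Ne.symm hab])]
  ring

lemma sum_split' (a b : V) (hab : a ≠ b) (g : Option {v : V // v ≠ b} → ℕ) :
    ∑ u : Option {v : V // v ≠ b}, g u = g (some ⟨a, hab⟩) +
      ∑ u ∈ (univ.erase (some a)).erase (some b), g (iota a b hab u) := by
  rw [← Finset.add_sum_erase univ g (mem_univ (some ⟨a, hab⟩))]
  congr 1
  refine Finset.sum_bij' (fun u _ => Option.map Subtype.val u) (fun u _ => iota a b hab u)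
    ?_ ?_ ?_ ?_ ?_
  · rintro (_ | ⟨u, hu⟩) h
    · simp
    · simp at h; simp [h, hu]
  · rintro (_ | u) h
    · simp [iota]
    · simp at h; simp [iota, h]
  · rintro (_ | ⟨u, hu⟩) h
    · simp [iota]
    · simp [iota, hu]
  · rintro (_ | u) h
    · simp [iota]
    · simp at h; simp [iota, h]
  · rintro (_ | ⟨u, hu⟩) h
    · simp [iota]
    · simp [iota, hu]

lemma inDeg_le (m : Option V → Option V → ℕ) (hs : ∀ u w, m u w = m w u)
    (o : Option V → Option V → ℕ) (ho : IsOrientation m o) (u : Option V) :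
    inDeg o u ≤ deg m u := by
  unfold inDeg deg
  apply Finset.sum_le_sum
  intro w _
  have := ho u w
  omega

lemma contract_iota (m : Option V → Option V → ℕ) (hG : IsGraph m)
    (a b : V) (hab : a ≠ b) (u w : Option V)
    (hu : u ∈ (univ.erase (some a)).erase (some b))
    (hw : w ∈ (univ.erase (some a)).erase (some b)) :
    contractM m a b (iota a b hab u) (iota a b hab w) = m u w := by
  obtain ⟨hs, hl, -⟩ := hG
  rcases u with _ | u <;> rcases w with _ | w <;> simp at hu hw <;>
    simp [iota, contractM, hu, hw, hl]

lemma contract_a (m : Option V → Option V → ℕ) (hG : IsGraph m)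
    (a b : V) (hab : a ≠ b) (v : V) (ha : v ≠ a) (hb : v ≠ b) :
    contractM m a b (some ⟨v, hb⟩) (some ⟨a, hab⟩) = m (some v) (some a) + m (some v) (some b) := by
  simp [contractM, ha]

lemma deg_contract (m : Option V → Option V → ℕ) (hG : IsGraph m)
    (a b : V) (hab : a ≠ b) (v : V) (ha : v ≠ a) (hb : v ≠ b) :
    deg (contractM m a b) (some ⟨v, hb⟩) = deg m (some v) := by
  unfold deg
  rw [sum_split a b hab, sum_split' a b hab, contract_a m hG a b hab v ha hb]
  congr 1
  apply Finset.sum_congr rfl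
  intro w hw
  have := contract_iota m hG a b hab (some v) w (by simp [ha, hb]) hw
  simpa [iota, hb] using this

def XX (m : Option V → Option V → ℕ) (a b : V) (hab : a ≠ b)
    (o : Option {v : V // v ≠ b} → Option {v : V // v ≠ b} → ℕ) (u : Option V) : ℕ :=
  min (o (iota a b hab u) (some ⟨a, hab⟩)) (m u (some a))

def YY (m : Option V → Option V → ℕ) (a b : V) (hab : a ≠ b)
    (o : Option {v : V // v ≠ b} → Option {v : V // v ≠ b} → ℕ) (u : Option V) : ℕ :=
  min (o (iota a b hab u) (some ⟨a, hab⟩) - XX m a b hab o u) (m u (some b))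

def lift (m : Option V → Option V → ℕ) (a b : V) (hab : a ≠ b)
    (o : Option {v : V // v ≠ b} → Option {v : V // v ≠ b} → ℕ) (p : ℕ)
    (u w : Option V) : ℕ :=
  if u = some a then
    if w = some a then 0 else if w = some b then p else m (some a) w - XX m a b hab o w
  else if u = some b then
    if w = some a then m (some a) (some b) - p else if w = some b then 0
    else m (some b) w - YY m a b hab o w
  else if w = some a then XX m a b hab o u else if w = some b then YY m a b hab o u
  else o (iota a b hab u) (iota a b hab w)

lemma lift_or (m : Option V → Option V → ℕ) (hG : IsGraph m) (a b : V) (hab : a ≠ b)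
    (o : Option {v : V // v ≠ b} → Option {v : V // v ≠ b} → ℕ)
    (ho : IsOrientation (contractM m a b) o) (p : ℕ) (hp : p ≤ m (some a) (some b)) :
    IsOrientation m (lift m a b hab o p) := by
  have hs := hG.1
  have hl := hG.2.1
  have hX : ∀ u, XX m a b hab o u ≤ m u (some a) := fun u => min_le_right _ _
  have hY : ∀ u, YY m a b hab o u ≤ m u (some b) := fun u => min_le_right _ _
  have hab' : (some a : Option V) ≠ some b := by simpa using hab
  intro u w
  have h1 := hX u
  have h2 := hX w
  have h3 := hY u
  have h4 := hY w
  have h5 := hs u w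
  by_cases ua : u = some a
  · subst ua
    by_cases wa : w = some a
    · subst wa; simp [lift, hl]
    by_cases wb : w = some b
    · subst wb; simp [lift, hab'.symm]; omega
    simp [lift, wa, wb]; omega
  by_cases ub : u = some b
  · subst ub
    by_cases wa : w = some a
    · subst wa; simp [lift, hab'.symm]; omega
    by_cases wb : w = some b
    · subst wb; simp [lift, hab'.symm, hl]
    simp [lift, wa, wb, hab'.symm]; omega
  by_cases wa : w = some a
  · subst wa; simp [lift, ua, ub]; omega
  by_cases wb : w = some b
  · subst wb; simp [lift, ua, ub, hab'.symm]; omega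
  simp only [lift, ua, ub, wa, wb, if_false]
  rw [ho, contract_iota m hG a b hab u w (by simp [ua, ub]) (by simp [wa, wb])]

lemma lift_in_a (m : Option V → Option V → ℕ) (a b : V) (hab : a ≠ b)
    (o : Option {v : V // v ≠ b} → Option {v : V // v ≠ b} → ℕ) (p : ℕ) :
    inDeg (lift m a b hab o p) (some a) = (m (some a) (some b) - p) +
      ∑ u ∈ (univ.erase (some a)).erase (some b), XX m a b hab o u := by
  unfold inDeg
  rw [sum_split a b hab]
  congr 1
  · simp [lift, hab.symm]
  · apply Finset.sum_congr rfl
    intro u hu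
    simp at hu
    simp [lift, hu]

lemma lift_in_b (m : Option V → Option V → ℕ) (a b : V) (hab : a ≠ b)
    (o : Option {v : V // v ≠ b} → Option {v : V // v ≠ b} → ℕ) (p : ℕ) :
    inDeg (lift m a b hab o p) (some b) = p +
      ∑ u ∈ (univ.erase (some a)).erase (some b), YY m a b hab o u := by
  unfold inDeg
  rw [sum_split a b hab]
  congr 1
  · simp [lift, hab.symm]
  · apply Finset.sum_congr rfl
    intro u hu
    simp at hu
    simp [lift, hu, hab.symm]

lemma lift_in_v (m : Option V → Option V → ℕ) (hG : IsGraph m) (a b : V) (hab : a ≠ b)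
    (o : Option {v : V // v ≠ b} → Option {v : V // v ≠ b} → ℕ)
    (ho : IsOrientation (contractM m a b) o) (p : ℕ) (v : V) (ha : v ≠ a) (hb : v ≠ b) :
    inDeg o (some ⟨v, hb⟩) ≤ inDeg (lift m a b hab o p) (some v) := by
  have hs := hG.1
  unfold inDeg
  rw [sum_split a b hab, sum_split' a b hab]
  apply add_le_add
  · have h := ho (some ⟨v, hb⟩) (some ⟨a, hab⟩)
    rw [contract_a m hG a b hab v ha hb] at h
    have e : iota a b hab (some v) = some ⟨v, hb⟩ := by simp [iota, hb]
    have h1 := hs (some a) (some v)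
    have h2 := hs (some b) (some v)
    simp [lift, hab.symm, ha, hb, XX, YY, e]
    omega
  · apply le_of_eq
    apply Finset.sum_congr rfl
    intro u hu
    simp at hu
    simp [lift, hu, ha, hb]
    simp [iota, hb]

lemma sum_XY (m : Option V → Option V → ℕ) (hG : IsGraph m) (a b : V) (hab : a ≠ b)
    (o : Option {v : V // v ≠ b} → Option {v : V // v ≠ b} → ℕ)
    (ho : IsOrientation (contractM m a b) o) :
    inDeg o (some ⟨a, hab⟩) ≤ ∑ u ∈ (univ.erase (some a)).erase (some b), XX m a b hab o u
      + ∑ u ∈ (univ.erase (some a)).erase (some b), YY m a b hab o u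
      + (m (some a) (some b) - 1) := by
  unfold inDeg
  rw [sum_split' a b hab]
  have h0 : o (some ⟨a, hab⟩) (some ⟨a, hab⟩) = 0 := by
    have := ho (some ⟨a, hab⟩) (some ⟨a, hab⟩)
    simp [contractM] at this
    exact this
  have hn : (none : Option V) ∈ (univ.erase (some a)).erase (some b) := by simp
  rw [h0, zero_add, ← Finset.sum_add_distrib]
  have hc : m (some a) (some b) - 1 = ∑ u ∈ (univ.erase (some a)).erase (some b),
      (if u = none then m (some a) (some b) - 1 else 0) := by
    rw [Finset.sum_ite_eq' _ none, if_pos hn]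
  rw [hc, ← Finset.sum_add_distrib]
  apply Finset.sum_le_sum
  rintro (_ | v) hv
  · have h := ho none (some ⟨a, hab⟩)
    simp [contractM] at h
    simp [XX, YY, iota]
    omega
  · simp at hv
    have hb := hv.1
    have h := ho (some ⟨v, hb⟩) (some ⟨a, hab⟩)
    rw [contract_a m hG a b hab v hv.2 hb] at h
    have e : iota a b hab (some v) = some ⟨v, hb⟩ := by simp [iota, hb]
    simp [XX, YY, e]
    omega

def conf (m : Option V → Option V → ℕ) (a b : V) (η : {v : V // v ≠ b} → ℕ) (L t : ℕ)
    (v : V) : ℕ :=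
  if h : v ≠ b then
    if v = a then deg m (some a) - (L - t) else η ⟨v, h⟩
  else deg m (some b) - t

/-- the restriction of `f` to `Sto_B(G)` is surjective onto
`Sto(G.e)`. -/
theorem fB_surjective (m : Option V → Option V → ℕ) (hG : IsGraph m)
    (a b : V) (hab : a ≠ b) (hk : 1 ≤ m (some a) (some b))
    (hnotbridge : (SimpleGraph.fromRel fun u w : Option V =>
      deleteM m a b u w ≠ 0).Connected) :
    ∀ η : {v : V // v ≠ b} → ℕ, Sto (contractM m a b) η →
      ∃ η' : V → ℕ, StoB m a b η' ∧ fB m a b hab η' = η := by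
  intro η hη
  have hs := hG.1
  obtain ⟨hst, o, ho, hc⟩ := hη
  set L := deg (contractM m a b) (some ⟨a, hab⟩) - η ⟨a, hab⟩ with hL
  have hstA := hst ⟨a, hab⟩
  have ca : ∀ t, conf m a b η L t a = deg m (some a) - (L - t) := by
    intro t; simp [conf, hab]
  have cb : ∀ t, conf m a b η L t b = deg m (some b) - t := by
    intro t; simp [conf]
  have cv : ∀ t v (hb : v ≠ b), v ≠ a → conf m a b η L t v = η ⟨v, hb⟩ := by
    intro t v hb ha; simp [conf, hb, ha]
  have stab : ∀ t, Stable m (conf m a b η L t) := by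
    intro t v
    by_cases hb : v = b
    · subst hb; rw [cb]; omega
    by_cases ha : v = a
    · subst ha; rw [ca]; omega
    rw [cv t v hb ha, ← deg_contract m hG a b hab v ha hb]
    exact hst _
  have ex : ∃ t, t ≤ L ∧ t ≤ deg m (some b) ∧ L - t ≤ deg m (some a) ∧
      ∃ o, IsOrientation m o ∧ Compatible m o (conf m a b η L t) := by
    have hXY := sum_XY m hG a b hab o ho
    have hcA := hc ⟨a, hab⟩
    have ia := lift_in_a m a b hab o
    have ib := lift_in_b m a b hab o
    generalize (∑ u ∈ (univ.erase (some a)).erase (some b), XX m a b hab o u) = SX at *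
    generalize (∑ u ∈ (univ.erase (some a)).erase (some b), YY m a b hab o u) = SY at *
    obtain ⟨p, hp, h1, h2⟩ : ∃ p, p ≤ m (some a) (some b) ∧
        1 ≤ (m (some a) (some b) - p) + SX ∧ 1 ≤ p + SY := by
      by_cases h : 1 ≤ SX
      · exact ⟨m (some a) (some b), le_rfl, by omega, by omega⟩
      by_cases h' : 1 ≤ SY
      · exact ⟨0, by omega, by omega, by omega⟩
      exact ⟨1, by omega, by omega, by omega⟩
    have hor := lift_or m hG a b hab o ho p hp
    have la := inDeg_le m hs _ hor (some a)
    have lb := inDeg_le m hs _ hor (some b)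
    have ia' := ia p
    have ib' := ib p
    refine ⟨min L (p + SY - 1), by omega, by omega, by omega, _, hor, ?_⟩
    intro v
    by_cases hb : v = b
    · subst hb; rw [cb]; omega
    by_cases ha : v = a
    · subst ha; rw [ca]; omega
    rw [cv _ v hb ha, ← deg_contract m hG a b hab v ha hb]
    have := lift_in_v m hG a b hab o ho p v ha hb
    have := hc ⟨v, hb⟩
    omega
  obtain ⟨t1, t2, t3, o1, ho1, hc1⟩ := Nat.find_spec ex
  have hmin := fun t (h : t < Nat.find ex) => Nat.find_min ex h
  generalize Nat.find ex = t at *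
  refine ⟨conf m a b η L t, ⟨⟨stab t, o1, ho1, hc1⟩, ?_⟩, ?_⟩
  · rintro ⟨-, q, hq, hqc, hq1, hlt⟩
    rw [cb] at hlt
    have hA := hqc a
    have hB := hqc b
    rw [ca] at hA
    rw [cb] at hB
    have la := inDeg_le m hs _ hq (some a)
    have hab' : (some a : Option V) ≠ some b := by simpa using hab
    let q' : Option V → Option V → ℕ := fun u w =>
      if u = some a ∧ w = some b then q u w - 1
      else if u = some b ∧ w = some a then q u w + 1 else q u w
    have hq' : IsOrientation m q' := by
      intro u w
      have h := hq u w
      by_cases h1 : u = some a ∧ w = some b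
      · obtain ⟨rfl, rfl⟩ := h1
        simp [q', hab.symm]; omega
      by_cases h2 : u = some b ∧ w = some a
      · obtain ⟨rfl, rfl⟩ := h2
        simp [q', hab.symm]; omega
      have h3 : ¬ (w = some a ∧ u = some b) := fun x => h2 x.symm
      have h4 : ¬ (w = some b ∧ u = some a) := fun x => h1 x.symm
      simp only [q', h1, h2, h3, h4, if_false]
      exact h
    have qa : inDeg q' (some a) = inDeg q (some a) + 1 := by
      unfold inDeg
      rw [sum_split a b hab, sum_split a b hab]
      have : ∑ u ∈ (univ.erase (some a)).erase (some b), q' u (some a) =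
          ∑ u ∈ (univ.erase (some a)).erase (some b), q u (some a) := by
        apply Finset.sum_congr rfl
        intro u hu
        simp at hu
        simp [q', hu]
      rw [this]
      simp [q', hab.symm, hab]
      omega
    have qb : inDeg q' (some b) + 1 = inDeg q (some b) := by
      unfold inDeg
      rw [sum_split a b hab, sum_split a b hab]
      have : ∑ u ∈ (univ.erase (some a)).erase (some b), q' u (some b) =
          ∑ u ∈ (univ.erase (some a)).erase (some b), q u (some b) := by
        apply Finset.sum_congr rfl
        intro u hu
        simp at hu
        simp [q', hu]
      rw [this]
      simp [q', hab.symm]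
      omega
    have qv : ∀ v, v ≠ a → v ≠ b → inDeg q' (some v) = inDeg q (some v) := by
      intro v ha hb
      simp [inDeg, q', ha, hb]
    apply hmin (t - 1) (by omega)
    refine ⟨by omega, by omega, by omega, q', hq', ?_⟩
    intro v
    by_cases hb : v = b
    · subst hb; rw [cb]; omega
    by_cases ha : v = a
    · subst ha; rw [ca]; omega
    have := hqc v
    rw [cv _ v hb ha] at this ⊢
    rw [qv v ha hb]
    exact this
  · funext ⟨v, hb⟩
    by_cases ha : v = a
    · subst ha
      simp only [fB, if_true]
      rw [ca, cb]
      omega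
    · simp only [fB, ha, if_false]
      exact cv t v hb ha

end SSM
end

section
/- The restriction of f to Sto_B(G) is injective: if η_1, η_2 ∈ Sto_B(G) satisfy l_{η_1}(a) + l_{η_1}(b) = l_{η_2}(a) + l_{η_2}(b) and l_{η_1}(v) = l_{η_2}(v) for all v ∈ V ∖ {a,b}, then η_1 = η_2. -/
open Finset Polynomial

open scoped Classical

namespace SSM

variable {V : Type*} [Fintype V] [DecidableEq V]

theorem aux_walk {α : Type*} (r : α → α → Prop) (a x : α) (h : Relation.ReflTransGen r a x) :
    x = a ∨ ∃ y, y ≠ a ∧ r a y ∧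
      Relation.ReflTransGen (fun u v => r u v ∧ u ≠ a ∧ v ≠ a) y x := by
  induction h with
  | refl => exact Or.inl rfl
  | @tail c z hc hz ih =>
    by_cases hza : z = a
    · exact Or.inl hza
    · right
      by_cases hca : c = a
      · subst hca
        exact ⟨z, hza, hz, Relation.ReflTransGen.refl⟩
      · rcases ih with h | ⟨y, hy, hay, hw⟩
        · exact absurd h hca
        · exact ⟨y, hy, hay, hw.tail ⟨hz, hca, hza⟩⟩

theorem aux_inDeg_ind (u v q : Option V) :
    (∑ p : Option V, if p = u ∧ q = v then 1 else 0) = if q = v then (1 : ℕ) else 0 := by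
  by_cases h : q = v <;> simp [h]

theorem aux_inDeg (o o' : Option V → Option V → ℕ) (u v u' v' : Option V)
    (h : ∀ p q, o' p q + (if p = u ∧ q = v then 1 else 0) =
      o p q + (if p = u' ∧ q = v' then 1 else 0)) (w : Option V) :
    inDeg o' w + (if w = v then 1 else 0) = inDeg o w + (if w = v' then 1 else 0) := by
  have := Finset.sum_congr (rfl : (Finset.univ : Finset (Option V)) = _)
    (fun p (_ : p ∈ Finset.univ) => h p w)
  rw [Finset.sum_add_distrib, Finset.sum_add_distrib, aux_inDeg_ind, aux_inDeg_ind] at this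
  exact this

theorem aux_flip (m o : Option V → Option V → ℕ) (u v : Option V) (huv : u ≠ v)
    (ho : IsOrientation m o) (h : 1 ≤ o u v) :
    ∃ o', IsOrientation m o' ∧ (∀ p q, o' p q + (if p = u ∧ q = v then 1 else 0) =
      o p q + (if p = v ∧ q = u then 1 else 0)) := by
  refine ⟨fun p q => o p q + (if p = v ∧ q = u then 1 else 0) -
    (if p = u ∧ q = v then 1 else 0), ?_, ?_⟩
  · intro p q
    have h1 := ho p q
    by_cases hp : p = u <;> by_cases hq : q = v <;> by_cases hp' : p = v <;>
      by_cases hq' : q = u <;> simp_all <;> omega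
  · intro p q
    by_cases hp : p = u ∧ q = v
    · obtain ⟨rfl, rfl⟩ := hp
      simp [huv]; omega
    · simp [hp]

theorem aux_path (m : Option V → Option V → ℕ) (n : ℕ) :
    ∀ (S : Finset (Option V)), S.card = n → ∀ (o : Option V → Option V → ℕ) (a x : Option V),
    IsOrientation m o → a ∈ S →
    Relation.ReflTransGen (fun u v => 1 ≤ o u v ∧ u ∈ S ∧ v ∈ S) a x →
    ∃ o', IsOrientation m o' ∧ ∀ w, inDeg o' w + (if w = x then 1 else 0) =
      inDeg o w + (if w = a then 1 else 0) := by
  induction n with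
  | zero =>
    intro S hS o a x ho ha
    rw [Finset.card_eq_zero] at hS
    simp [hS] at ha
  | succ n ih =>
    intro S hS o a x ho ha hw
    rcases aux_walk _ _ _ hw with rfl | ⟨y, hya, ⟨hay, _, hyS⟩, hw'⟩
    · exact ⟨o, ho, fun _ => rfl⟩
    · obtain ⟨o', ho', hf⟩ := aux_flip m o a y (Ne.symm hya) ho hay
      have hd := aux_inDeg _ _ _ _ _ _ hf
      obtain ⟨o'', ho'', hd'⟩ := ih (S.erase a) (by rw [Finset.card_erase_of_mem ha]; omega)
        o' y x ho' (by simp [hya, hyS]) (by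
          refine Relation.ReflTransGen.mono ?_ _ _ hw'
          rintro p q ⟨⟨h1, h2, h3⟩, h4, h5⟩
          have := hf p q
          simp [h4, h5] at this
          refine ⟨by omega, by simp [h4, h2], by simp [h5, h3]⟩)
      refine ⟨o'', ho'', fun w => ?_⟩
      have := hd w
      have := hd' w
      omega

theorem aux_cut (m o1 o2 : Option V → Option V → ℕ) (R : Finset (Option V))
    (h1 : IsOrientation m o1) (h2 : IsOrientation m o2)
    (hR : ∀ w ∈ R, ∀ u, u ∉ R → o1 w u = 0) :
    ∑ w ∈ R, inDeg o2 w ≤ ∑ w ∈ R, inDeg o1 w := by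
  have split : ∀ o : Option V → Option V → ℕ, ∑ w ∈ R, inDeg o w =
      ∑ w ∈ R, ∑ u ∈ R, o u w + ∑ w ∈ R, ∑ u ∈ Rᶜ, o u w := by
    intro o
    rw [← Finset.sum_add_distrib]
    refine Finset.sum_congr rfl fun w _ => ?_
    rw [Finset.sum_add_sum_compl]; rfl
  have dbl : ∀ o : Option V → Option V → ℕ, IsOrientation m o →
      2 * ∑ w ∈ R, ∑ u ∈ R, o u w = ∑ w ∈ R, ∑ u ∈ R, m u w := by
    intro o ho
    have hc : ∑ w ∈ R, ∑ u ∈ R, o u w = ∑ w ∈ R, ∑ u ∈ R, o w u := Finset.sum_comm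
    rw [two_mul]
    nth_rw 2 [hc]
    rw [← Finset.sum_add_distrib]
    refine Finset.sum_congr rfl fun w _ => ?_
    rw [← Finset.sum_add_distrib]
    exact Finset.sum_congr rfl fun u _ => ho u w
  have hle : ∑ w ∈ R, ∑ u ∈ Rᶜ, o2 u w ≤ ∑ w ∈ R, ∑ u ∈ Rᶜ, o1 u w := by
    refine Finset.sum_le_sum fun w hw => Finset.sum_le_sum fun u hu => ?_
    have := h1 u w
    have := h2 u w
    have := hR w hw u (by simpa using hu)
    omega
  have := dbl o1 h1
  have := dbl o2 h2
  rw [split, split]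
  omega

theorem aux_core (m : Option V → Option V → ℕ) (hG : IsGraph m)
    (a b : V) (hab : a ≠ b) (hk : 1 ≤ m (some a) (some b))
    (η₁ η₂ : V → ℕ) (h₁ : StoB m a b η₁) (h₂ : Sto m η₂)
    (hb : η₁ b < deg m (some b)) (ha : η₂ a < η₁ a)
    (hother : ∀ v : V, v ≠ a → v ≠ b → η₁ v = η₂ v) : False := by
  obtain ⟨⟨hs1, o1, ho1, hc1⟩, hA⟩ := h₁
  obtain ⟨hs2, o2, ho2, hc2⟩ := h₂
  apply hA
  refine ⟨hs1, ?_⟩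
  by_cases hab1 : 1 ≤ o1 (some a) (some b)
  · exact ⟨o1, ho1, hc1, hab1, hb⟩
  have hba : 1 ≤ o1 (some b) (some a) := by
    have := ho1 (some a) (some b)
    omega
  have hab' : (some a : Option V) ≠ some b := by simpa using hab
  let m' : Option V → Option V → ℕ := fun p q =>
    m p q - (if p = some b ∧ q = some a then 1 else 0) - (if p = some a ∧ q = some b then 1 else 0)
  let o' : Option V → Option V → ℕ := fun p q =>
    o1 p q - (if p = some b ∧ q = some a then 1 else 0)
  have hk' : 1 ≤ m (some b) (some a) := by rw [hG.1]; exact hk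
  have hm' : ∀ p q, m' p q + (if p = some b ∧ q = some a then 1 else 0) +
      (if p = some a ∧ q = some b then 1 else 0) = m p q := by
    intro p q
    simp only [m']
    split_ifs with h1 h2 h2
    · exact absurd (h2.1.symm.trans h1.1) hab'
    · obtain ⟨rfl, rfl⟩ := h1; omega
    · obtain ⟨rfl, rfl⟩ := h2; omega
    · omega
  have hof : ∀ p q, o' p q + (if p = some b ∧ q = some a then 1 else 0) = o1 p q := by
    intro p q
    simp only [o']
    split_ifs with h1
    · obtain ⟨rfl, rfl⟩ := h1; omega
    · omega
  have swap : ∀ (p q s t : Option V), (if p = s ∧ q = t then (1:ℕ) else 0) =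
      if q = t ∧ p = s then 1 else 0 := by
    intro p q s t
    simp only [and_comm]
  have ho' : IsOrientation m' o' := by
    intro p q
    have e1 := hm' p q
    have e2 := hof p q
    have e3 := hof q p
    have e4 := ho1 p q
    rw [swap q p] at e3
    omega
  have hd' : ∀ w, inDeg o' w + (if w = some a then 1 else 0) = inDeg o1 w := by
    intro w
    have := Finset.sum_congr (rfl : (Finset.univ : Finset (Option V)) = _)
      (fun p (_ : p ∈ Finset.univ) => hof p w)
    rw [Finset.sum_add_distrib, aux_inDeg_ind] at this
    exact this
  by_cases hx : ∃ x, Relation.ReflTransGen (fun u v => 1 ≤ o' u v) (some a) x ∧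
      ∀ v, x = some v → v ≠ b → deg m (some v) + 1 < inDeg o1 (some v) + η₁ v
  · obtain ⟨x, hw, hx⟩ := hx
    obtain ⟨o, ho, hd⟩ := aux_path m' _ Finset.univ rfl o' (some a) x ho' (by simp)
      (by simpa using hw)
    refine ⟨fun p q => o p q + (if p = some a ∧ q = some b then 1 else 0), ?_, ?_, by simp, hb⟩
    · intro p q
      have e1 := hm' p q
      have e2 := ho p q
      rw [swap p q (some b)] at e1
      simp only
      omega
    · intro v
      have e : inDeg (fun p q => o p q + (if p = some a ∧ q = some b then 1 else 0)) (some v)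
          = inDeg o (some v) + (if some v = some b then 1 else 0) := by
        unfold inDeg
        rw [Finset.sum_add_distrib, aux_inDeg_ind]
      rw [e]
      have e1 := hd (some v)
      have e2 := hd' (some v)
      have e3 := hc1 v
      by_cases hvx : some v = x
      · by_cases hvb : v = b
        · simp only [hvb, if_true] at *
          split_ifs at * <;> omega
        · have := hx v hvx.symm hvb
          split_ifs at * <;> omega
      · split_ifs at * <;> omega
  · exfalso
    push Not at hx
    let R : Finset (Option V) := Finset.univ.filter
      (fun x => Relation.ReflTransGen (fun u v => 1 ≤ o' u v) (some a) x)
    have hmem : ∀ x, x ∈ R ↔ Relation.ReflTransGen (fun u v => 1 ≤ o' u v) (some a) x := by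
      intro x; simp [R]
    have haR : some a ∈ R := (hmem _).2 Relation.ReflTransGen.refl
    have hbR : some b ∉ R := by
      intro h
      obtain ⟨v, hv, hvb, _⟩ := hx _ ((hmem _).1 h)
      exact hvb (by simpa using hv.symm)
    have hcut := aux_cut m o1 o2 R ho1 ho2 (by
      intro w hw u hu
      by_contra hne
      apply hu
      rw [hmem] at hw ⊢
      refine hw.tail ?_
      have e := hof w u
      have : w ≠ some b := fun h => hbR ((hmem _).2 (h ▸ hw))
      simp [this] at e
      omega)
    refine absurd hcut (not_le.2 (Finset.sum_lt_sum ?_ ⟨some a, haR, ?_⟩))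
    · intro w hw
      obtain ⟨v, rfl, hvb, hle⟩ := hx _ ((hmem _).1 hw)
      have e := hc2 v
      by_cases hva : v = a
      · subst hva; omega
      · have := hother v hva hvb
        omega
    · obtain ⟨v, hv, hvb, hle⟩ := hx _ ((hmem _).1 haR)
      obtain rfl : a = v := by simpa using hv
      have e := hc2 a
      omega

/-- the restriction of `f` to `Sto_B(G)` is injective: two
configurations of `Sto_B(G)` agreeing in lacking numbers away from `a, b` and in
the sum `l(a) + l(b)` are equal. -/
theorem fB_injective (m : Option V → Option V → ℕ) (hG : IsGraph m)
    (a b : V) (hab : a ≠ b) (hk : 1 ≤ m (some a) (some b))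
    (hnotbridge : (SimpleGraph.fromRel fun u w : Option V =>
      deleteM m a b u w ≠ 0).Connected)
    (η₁ η₂ : V → ℕ) (h₁ : StoB m a b η₁) (h₂ : StoB m a b η₂)
    (hsum : (deg m (some a) - η₁ a) + (deg m (some b) - η₁ b) =
      (deg m (some a) - η₂ a) + (deg m (some b) - η₂ b))
    (hother : ∀ v : V, v ≠ a → v ≠ b →
      deg m (some v) - η₁ v = deg m (some v) - η₂ v) :
    η₁ = η₂ := by
  have s1 := h₁.1.1
  have s2 := h₂.1.1
  have ho : ∀ v : V, v ≠ a → v ≠ b → η₁ v = η₂ v := by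
    intro v hva hvb
    have := hother v hva hvb
    have := s1 v
    have := s2 v
    omega
  have a1 := s1 a
  have a2 := s2 a
  have b1 := s1 b
  have b2 := s2 b
  rcases lt_trichotomy (η₁ b) (η₂ b) with h | h | h
  · exact (aux_core m hG a b hab hk η₁ η₂ h₁ h₂.1 (by omega) (by omega) ho).elim
  · funext v
    by_cases hva : v = a
    · subst hva; omega
    · by_cases hvb : v = b
      · subst hvb; exact h
      · exact ho v hva hvb
  · exact (aux_core m hG a b hab hk η₂ η₁ h₂ h₁.1 (by omega) (by omega)
      (fun v h1 h2 => (ho v h1 h2).symm)).elim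

end SSM
end
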